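/- arXiv:2505.04973 — 3 statements merged into one kernel-verified Lean document; each statement's English description precedes it below -/
import Mathlib

section
/- Let p₁, q₁, p₂, q₂ be positive integers with q₁, q₂ ≥ 2, 1 ≤ pᵢ < qᵢ, gcd(pᵢ, qᵢ) = 1 for i = 1, 2, and (p₁, q₁) ≠ (p₂, q₂). Then there exist integers a, b, c, d with a·d − b·c = 1, c ≠ 0, (a : ℚ)/c = p₂/q₂, and c·(p₁/q₁ : ℚ) + d = 0, if and only if q₁ = q₂ and q₁ divides p₁·p₂ + 1. -/
/-- Two reduced fractions of integers with equal value have associated denominators. -/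
theorem Int.natAbs_eq_natAbs_of_isCoprime_of_mul_eq_mul {a c p q : ℤ}
    (hac : IsCoprime a c) (hpq : IsCoprime p q) (h : a * q = p * c) : c.natAbs = q.natAbs :=
  Int.natAbs_eq_of_dvd_dvd (hac.symm.dvd_of_dvd_mul_left (h ▸ dvd_mul_left c p))
    (hpq.symm.dvd_of_dvd_mul_left (h ▸ dvd_mul_left q a))

/-- Two vertical geodesics from `p₁/q₁` and `p₂/q₂` to `∞` project to the same geodesic on
the modular surface (i.e. some `σ = (a b; c d) ∈ SL(2,ℤ)` with `c ≠ 0` sends `∞` to `p₂/q₂`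
and `p₁/q₁` to `∞`) iff `q₁ = q₂` and `q₁ ∣ p₁p₂ + 1`. -/
theorem same_projected_geodesic_iff (p₁ q₁ p₂ q₂ : ℕ)
    (hq₁ : 2 ≤ q₁) (hq₂ : 2 ≤ q₂)
    (hp₁l : 1 ≤ p₁) (hp₁u : p₁ < q₁) (hp₂l : 1 ≤ p₂) (hp₂u : p₂ < q₂)
    (hco₁ : Nat.gcd p₁ q₁ = 1) (hco₂ : Nat.gcd p₂ q₂ = 1)
    (hne : (p₁, q₁) ≠ (p₂, q₂)) :
    (∃ a b c d : ℤ, a * d - b * c = 1 ∧ c ≠ 0 ∧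
        (a : ℚ) / (c : ℚ) = (p₂ : ℚ) / (q₂ : ℚ) ∧
        (c : ℚ) * ((p₁ : ℚ) / (q₁ : ℚ)) + (d : ℚ) = 0)
      ↔ (q₁ = q₂ ∧ q₁ ∣ p₁ * p₂ + 1) := by
  have hq₁' : (q₁ : ℚ) ≠ 0 := by positivity
  have hq₂' : (q₂ : ℚ) ≠ 0 := by positivity
  constructor
  · rintro ⟨a, b, c, d, hdet, hc, hac, hcd⟩
    have hc' : (c : ℚ) ≠ 0 := by exact_mod_cast hc
    have h₂ : a * q₂ = p₂ * c := by
      rw [div_eq_div_iff hc' hq₂'] at hac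
      exact_mod_cast hac
    have h₁ : -d * q₁ = p₁ * c := by
      field_simp at hcd
      rw [mul_zero] at hcd
      have : c * (p₁ : ℤ) + q₁ * d = 0 := by exact_mod_cast hcd
      linarith
    have hc₂ : c.natAbs = q₂ := Int.natAbs_eq_natAbs_of_isCoprime_of_mul_eq_mul
      ⟨d, -b, by linarith⟩ (Nat.isCoprime_iff_coprime.mpr hco₂) h₂
    have hc₁ : c.natAbs = q₁ := Int.natAbs_eq_natAbs_of_isCoprime_of_mul_eq_mul
      ⟨-a, -b, by linarith⟩ (Nat.isCoprime_iff_coprime.mpr hco₁) h₁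
    refine ⟨hc₁.symm.trans hc₂, ?_⟩
    rw [← hc₁, ← Int.natCast_dvd_natCast, Int.natAbs_dvd]
    refine ⟨-b, ?_⟩
    have hsq : (q₁ : ℤ) * q₂ = c * c := by
      rw [← Int.natAbs_mul_self, ← hc₂, ← hc₁, Nat.cast_mul]
    have hprod : (p₁ * p₂ : ℤ) = -(a * d) := by
      apply mul_right_cancel₀ (mul_ne_zero hc hc)
      linear_combination
        -((p₂ : ℤ) * c) * h₁ + d * (q₁ : ℤ) * h₂ - a * d * hsq
    push_cast
    linear_combination hprod - hdet
  · rintro ⟨rfl, k, hk⟩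
    have hk' : (p₁ * p₂ + 1 : ℤ) = q₁ * k := by exact_mod_cast hk
    refine ⟨p₂, -k, q₁, -p₁, by linear_combination -hk', by positivity, by simp, ?_⟩
    push_cast
    field_simp
    ring
end

section
/- For every integer q ≥ 1, s_q ≤ √q. -/
/-- `sojournS q` is the number of integers `p` with `1 ≤ p < q` and `p² ≡ -1 (mod q)`,
with the convention `sojournS 1 = 1`. -/
def sojournS (q : ℕ) : ℕ :=
  if q = 1 then 1 else ((Finset.Ico 1 q).filter (fun p => q ∣ p ^ 2 + 1)).card

/-- The residues `p < q` with `p ^ 2 ≡ -1 (mod q)`. -/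
def rootsNegOne (q : ℕ) : Finset ℕ := (Finset.range q).filter (fun p => q ∣ p ^ 2 + 1)

lemma mem_rootsNegOne {q p : ℕ} : p ∈ rootsNegOne q ↔ p < q ∧ q ∣ p ^ 2 + 1 := by
  simp [rootsNegOne]

lemma mod_mem_rootsNegOne {q p : ℕ} (hq : 0 < q) (h : q ∣ p ^ 2 + 1) :
    p % q ∈ rootsNegOne q :=
  mem_rootsNegOne.2 ⟨Nat.mod_lt _ hq,
    ((((Nat.mod_modEq p q).pow 2).add_right 1).dvd_iff dvd_rfl).2 h⟩

lemma card_rootsNegOne_mul_le {a b : ℕ} (ha : 0 < a) (hb : 0 < b) (hab : a.Coprime b) :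
    (rootsNegOne (a * b)).card ≤ (rootsNegOne a).card * (rootsNegOne b).card := by
  rw [← Finset.card_product]
  refine Finset.card_le_card_of_injOn (fun x => (x % a, x % b)) ?_ ?_
  · intro x hx
    have h := (mem_rootsNegOne.1 hx).2
    exact Finset.mem_product.2 ⟨mod_mem_rootsNegOne ha ((dvd_mul_right a b).trans h),
      mod_mem_rootsNegOne hb ((dvd_mul_left b a).trans h)⟩
  · intro x hx y hy hxy
    obtain ⟨h₁, h₂⟩ := Prod.mk.inj hxy
    exact ((Nat.modEq_and_modEq_iff_modEq_mul hab).1 ⟨h₁, h₂⟩).eq_of_lt_of_lt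
      (mem_rootsNegOne.1 hx).1 (mem_rootsNegOne.1 hy).1

lemma rootsNegOne_eq_empty_of_four_dvd {q : ℕ} (h : 4 ∣ q) : rootsNegOne q = ∅ := by
  refine Finset.eq_empty_of_forall_notMem fun x hx => ?_
  have h4 := Nat.mod_eq_zero_of_dvd (h.trans (mem_rootsNegOne.1 hx).2)
  have : x % 4 < 4 := Nat.mod_lt _ (by norm_num)
  interval_cases hr : x % 4 <;> simp [Nat.add_mod, Nat.pow_mod, hr] at h4

lemma rootsNegOne_eq_empty_of_three_dvd {q : ℕ} (h : 3 ∣ q) : rootsNegOne q = ∅ := by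
  refine Finset.eq_empty_of_forall_notMem fun x hx => ?_
  have h3 := Nat.mod_eq_zero_of_dvd (h.trans (mem_rootsNegOne.1 hx).2)
  have : x % 3 < 3 := Nat.mod_lt _ (by norm_num)
  interval_cases hr : x % 3 <;> simp [Nat.add_mod, Nat.pow_mod, hr] at h3

lemma card_rootsNegOne_prime_pow_le_two {p : ℕ} (hp : p.Prime) (hp2 : p ≠ 2) {k : ℕ}
    (hk : k ≠ 0) : (rootsNegOne (p ^ k)).card ≤ 2 := by
  obtain h | ⟨x, hx⟩ := (rootsNegOne (p ^ k)).eq_empty_or_nonempty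
  · simp [h]
  refine (Finset.card_le_card (t := {x, p ^ k - x}) fun y hy => ?_).trans Finset.card_le_two
  obtain ⟨hxlt, hxd⟩ := mem_rootsNegOne.1 hx
  obtain ⟨hylt, hyd⟩ := mem_rootsNegOne.1 hy
  have hpZ : Prime (p : ℤ) := Nat.prime_iff_prime_int.1 hp
  have hxd' : (p : ℤ) ^ k ∣ (x : ℤ) ^ 2 + 1 := by exact_mod_cast hxd
  have hyd' : (p : ℤ) ^ k ∣ (y : ℤ) ^ 2 + 1 := by exact_mod_cast hyd
  have hprod : (p : ℤ) ^ k ∣ ((x : ℤ) - y) * (x + y) := by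
    have h := dvd_sub hxd' hyd'
    rwa [show (x : ℤ) ^ 2 + 1 - ((y : ℤ) ^ 2 + 1) = ((x : ℤ) - y) * (x + y) by ring] at h
  have hpx : ¬ (p : ℤ) ∣ x := fun h => by
    have h1 : (p : ℤ) ∣ (x : ℤ) ^ 2 + 1 := (dvd_pow_self _ hk).trans hxd'
    exact hpZ.not_isUnit (isUnit_of_dvd_one ((dvd_add_right (h.pow two_ne_zero)).1 h1))
  have hnot : ¬ ((p : ℤ) ∣ (x : ℤ) - y ∧ (p : ℤ) ∣ (x : ℤ) + y) := fun ⟨h1, h2⟩ => by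
    have h3 : (p : ℤ) ∣ 2 * x := by
      have h := dvd_add h1 h2
      rwa [show (x : ℤ) - y + (x + y) = 2 * x by ring] at h
    obtain h | h := hpZ.dvd_or_dvd h3
    · exact hp2 ((Nat.prime_dvd_prime_iff_eq hp Nat.prime_two).1 (by exact_mod_cast h))
    · exact hpx h
  have hxlt' : (x : ℤ) < (p : ℤ) ^ k := by exact_mod_cast hxlt
  have hylt' : (y : ℤ) < (p : ℤ) ^ k := by exact_mod_cast hylt
  rw [Finset.mem_insert, Finset.mem_singleton]
  by_cases h1 : (p : ℤ) ∣ (x : ℤ) - y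
  · have h2 : ¬ (p : ℤ) ∣ (x : ℤ) + y := fun h => hnot ⟨h1, h⟩
    have h3 := hpZ.pow_dvd_of_dvd_mul_right k h2 hprod
    have h4 := Int.eq_zero_of_abs_lt_dvd h3 (abs_lt.2 ⟨by linarith, by linarith⟩)
    left; omega
  · have h3 := hpZ.pow_dvd_of_dvd_mul_left k h1 hprod
    have hx0 : x ≠ 0 := by
      rintro rfl
      simp at hpx
    have h4 : (p : ℤ) ^ k ∣ (x : ℤ) + y - (p : ℤ) ^ k := dvd_sub h3 dvd_rfl
    have h5 := Int.eq_zero_of_abs_lt_dvd h4 (abs_lt.2 ⟨by omega, by linarith⟩)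
    have h6 : x + y = p ^ k := by
      have : ((x : ℤ) + y) = (p : ℤ) ^ k := by linarith
      exact_mod_cast this
    right; omega

lemma card_rootsNegOne_prime_pow_sq_le {p : ℕ} (hp : p.Prime) {k : ℕ} (hk : k ≠ 0) :
    (rootsNegOne (p ^ k)).card ^ 2 ≤ p ^ k := by
  by_cases hp2 : p = 2
  · subst hp2
    obtain rfl | hk2 : k = 1 ∨ 2 ≤ k := by omega
    · decide
    · have h4 : 4 ∣ 2 ^ k := pow_dvd_pow 2 hk2
      simp [rootsNegOne_eq_empty_of_four_dvd h4]
  by_cases hp3 : p = 3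
  · have h3 : 3 ∣ p ^ k := hp3 ▸ dvd_pow_self p hk
    simp [rootsNegOne_eq_empty_of_three_dvd h3]
  have hp4 : 4 ≤ p := by
    have := hp.two_le
    omega
  calc (rootsNegOne (p ^ k)).card ^ 2 ≤ 2 ^ 2 :=
        Nat.pow_le_pow_left (card_rootsNegOne_prime_pow_le_two hp hp2 hk) 2
    _ ≤ p := hp4
    _ ≤ p ^ k := Nat.le_self_pow hk p

lemma card_rootsNegOne_sq_le {q : ℕ} (hq : 0 < q) : (rootsNegOne q).card ^ 2 ≤ q := by
  induction q using Nat.recOnPosPrimePosCoprime with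
  | zero => exact absurd hq (lt_irrefl 0)
  | one => decide
  | prime_pow p k hp hk => exact card_rootsNegOne_prime_pow_sq_le hp hk.ne'
  | coprime a b ha hb hab iha ihb =>
    calc (rootsNegOne (a * b)).card ^ 2
        ≤ ((rootsNegOne a).card * (rootsNegOne b).card) ^ 2 :=
          Nat.pow_le_pow_left (card_rootsNegOne_mul_le (by omega) (by omega) hab) 2
      _ = (rootsNegOne a).card ^ 2 * (rootsNegOne b).card ^ 2 := mul_pow _ _ _
      _ ≤ a * b := Nat.mul_le_mul (iha (by omega)) (ihb (by omega))

lemma sojournS_le_card_rootsNegOne (q : ℕ) : sojournS q ≤ (rootsNegOne q).card := by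
  unfold sojournS
  split_ifs with h
  · subst h
    decide
  · refine Finset.card_le_card fun p hp => ?_
    obtain ⟨hp1, hp2⟩ := Finset.mem_filter.1 hp
    exact mem_rootsNegOne.2 ⟨(Finset.mem_Ico.1 hp1).2, hp2⟩

/-- For every `q ≥ 1`, `s_q ≤ √q`. -/
theorem sq_le_sqrt (q : ℕ) (hq : 1 ≤ q) :
    (sojournS q : ℝ) ≤ Real.sqrt q := by
  refine Real.le_sqrt_of_sq_le ?_
  exact_mod_cast (Nat.pow_le_pow_left (sojournS_le_card_rootsNegOne q) 2).trans
    (card_rootsNegOne_sq_le hq)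
end

section
/- Let O denote the set of positive integers all of whose prime factors are congruent to 1 modulo 4 (so 1 ∈ O), and let χ be the unique nontrivial Dirichlet character modulo 4 (χ(n) = 0 for n even, χ(n) = 1 for n ≡ 1 (mod 4), χ(n) = −1 for n ≡ 3 (mod 4)). Then for every complex number s with Re(s) > 1, Σ_{n ∈ O} 2^{ω(n)}·n^{−s} = ζ(s)·L(s, χ) / ((1 + 2^{−s})·ζ(2s)), where ζ is the Riemann zeta function and L(s, χ) is the Dirichlet L-function of χ. -/
/-- `Oset` is the set of positive integers all of whose prime factors are `≡ 1 (mod 4)`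
(in particular `1 ∈ Oset`). -/
def Oset : Set ℕ := {n | 0 < n ∧ ∀ p ∈ n.primeFactors, p % 4 = 1}

/-- The unique nontrivial Dirichlet character modulo 4: `χ(n) = 0` for `n` even,
`χ(n) = 1` for `n ≡ 1 (mod 4)`, `χ(n) = -1` for `n ≡ 3 (mod 4)`. -/
def chi4 (n : ℕ) : ℂ :=
  if n % 4 = 1 then 1 else if n % 4 = 3 then -1 else 0

lemma two_pow_card_primeFactors_le_card_divisors {n : ℕ} (hn : n ≠ 0) :
    2 ^ n.primeFactors.card ≤ n.divisors.card := by
  rw [Nat.card_divisors hn, ← Finset.prod_const]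
  refine Finset.prod_le_prod' fun p hp ↦ ?_
  have hp' := Nat.mem_primeFactors.mp hp
  have := hp'.1.factorization_pos_of_dvd hn hp'.2.1
  omega

/-- `n ↦ 2 ^ ω(n)` has an absolutely convergent Dirichlet series for `1 < re s`. -/
lemma summable_norm_two_pow_card_primeFactors_mul_cpow {s : ℂ} (hs : 1 < s.re) :
    Summable fun n : ℕ ↦ ‖(2 ^ n.primeFactors.card : ℂ) * (n : ℂ) ^ (-s)‖ := by
  have h1 : LSeriesSummable 1 s := LSeriesSummable_one_iff.mpr hs
  refine (h1.convolution h1).norm.of_nonneg_of_le (fun _ ↦ norm_nonneg _) fun n ↦ ?_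
  have hs0 : s ≠ 0 := Complex.ne_zero_of_one_lt_re hs
  rcases eq_or_ne n 0 with rfl | hn
  · simp [hs0]
  · have hconv : LSeries.convolution 1 1 n = (n.divisors.card : ℂ) := by
      rw [LSeries.convolution_def]
      simp [← Nat.map_div_right_divisors]
    rw [LSeries.term_of_ne_zero hn, hconv, div_eq_mul_inv, ← Complex.cpow_neg, norm_mul, norm_mul]
    gcongr
    simpa using mod_cast two_pow_card_primeFactors_le_card_divisors hn

lemma mul_mem_Oset_iff {m n : ℕ} : m * n ∈ Oset ↔ m ∈ Oset ∧ n ∈ Oset := by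
  rcases eq_or_ne m 0 with rfl | hm
  · simp [Oset]
  rcases eq_or_ne n 0 with rfl | hn
  · simp [Oset]
  simp only [Oset, Set.mem_ofPred_eq, Nat.primeFactors_mul hm hn, Finset.mem_union, or_imp,
    forall_and, Nat.pos_of_ne_zero hm, Nat.pos_of_ne_zero hn, Nat.mul_pos, true_and]

lemma one_mem_Oset : 1 ∈ Oset := ⟨one_pos, by rw [Nat.primeFactors_one]; simp⟩

lemma prime_pow_succ_mem_Oset_iff {p : ℕ} (hp : p.Prime) (e : ℕ) :
    p ^ (e + 1) ∈ Oset ↔ p % 4 = 1 := by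
  rw [Oset, Set.mem_ofPred_eq, Nat.primeFactors_prime_pow e.succ_ne_zero hp]
  simp only [Finset.mem_singleton, forall_eq, pow_pos hp.pos, true_and]

lemma norm_prime_cpow_neg_lt_one {p : ℕ} (hp : p.Prime) {s : ℂ} (hs : 0 < s.re) :
    ‖(p : ℂ) ^ (-s)‖ < 1 := by
  rw [Complex.norm_natCast_cpow_of_pos hp.pos]
  exact Real.rpow_lt_one_of_one_lt_of_neg (mod_cast hp.one_lt) (by simpa using hs)

/-- The summand of the Dirichlet series over `Oset`, extended by zero to all of `ℕ`. -/
noncomputable def osetSummand (s : ℂ) (n : ℕ) : ℂ :=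
  Oset.indicator (fun n ↦ (2 ^ n.primeFactors.card : ℂ) * (n : ℂ) ^ (-s)) n

lemma osetSummand_one (s : ℂ) : osetSummand s 1 = 1 := by
  simp [osetSummand, one_mem_Oset]

lemma osetSummand_mul (s : ℂ) {m n : ℕ} (h : m.Coprime n) :
    osetSummand s (m * n) = osetSummand s m * osetSummand s n := by
  by_cases hm : m ∈ Oset
  · by_cases hn : n ∈ Oset
    · simp only [osetSummand, Set.indicator_of_mem (mul_mem_Oset_iff.mpr ⟨hm, hn⟩),
        Set.indicator_of_mem hm, Set.indicator_of_mem hn, h.primeFactors_mul,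
        Finset.card_union_of_disjoint h.disjoint_primeFactors, pow_add, Nat.cast_mul,
        Complex.natCast_mul_natCast_cpow]
      ring
    · simp [osetSummand, mul_mem_Oset_iff, hn]
  · simp [osetSummand, mul_mem_Oset_iff, hm]

lemma tsum_osetSummand_prime_pow {s : ℂ} (hs : 1 < s.re) {p : ℕ} (hp : p.Prime) :
    ∑' e, osetSummand s (p ^ e) =
      if p % 4 = 1 then (1 + (p : ℂ) ^ (-s)) / (1 - (p : ℂ) ^ (-s)) else 1 := by
  have hx := norm_prime_cpow_neg_lt_one hp (s := s) (by linarith)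
  split_ifs with h
  · have hx1 : 1 - (p : ℂ) ^ (-s) ≠ 0 := sub_ne_zero.mpr fun h' ↦ by simp [← h'] at hx
    have hterm (e : ℕ) :
        osetSummand s (p ^ (e + 1)) = 2 * (p : ℂ) ^ (-s) * ((p : ℂ) ^ (-s)) ^ e := by
      rw [osetSummand, Set.indicator_of_mem ((prime_pow_succ_mem_Oset_iff hp e).mpr h),
        Nat.primeFactors_prime_pow e.succ_ne_zero hp, Finset.card_singleton, pow_one, mul_assoc,
        ← pow_succ']
      exact congrArg (2 * ·)
        (map_pow (riemannZetaSummandHom (Complex.ne_zero_of_one_lt_re hs)) p (e + 1))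
    have hsum : HasSum (fun e ↦ osetSummand s (p ^ (e + 1)))
        (2 * (p : ℂ) ^ (-s) * (1 - (p : ℂ) ^ (-s))⁻¹) := by
      simp only [hterm]
      exact (hasSum_geometric_of_norm_lt_one hx).mul_left _
    have hsummable : Summable fun e ↦ osetSummand s (p ^ e) :=
      (summable_nat_add_iff (f := fun e ↦ osetSummand s (p ^ e)) 1).mp hsum.summable
    rw [hsummable.tsum_eq_zero_add, hsum.tsum_eq, pow_zero,
      osetSummand_one]
    field_simp
    ring
  · rw [tsum_eq_single 0 fun e he ↦ ?_, pow_zero, osetSummand_one]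
    obtain ⟨e, rfl⟩ := Nat.exists_eq_succ_of_ne_zero he
    exact Set.indicator_of_notMem (mt (prime_pow_succ_mem_Oset_iff hp e).mp h) _

lemma hasProd_osetSummand {s : ℂ} (hs : 1 < s.re) :
    HasProd (fun p : Nat.Primes ↦
      if (p : ℕ) % 4 = 1 then (1 + (p : ℂ) ^ (-s)) / (1 - (p : ℂ) ^ (-s)) else 1)
      (∑' n, osetSummand s n) := by
  have hsum : Summable (‖osetSummand s ·‖) :=
    (summable_norm_two_pow_card_primeFactors_mul_cpow hs).of_nonneg_of_le
      (fun _ ↦ norm_nonneg _) fun n ↦ norm_indicator_le_norm_self _ n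
  convert EulerProduct.eulerProduct_hasProd (osetSummand_one s) (osetSummand_mul s) hsum
    (by simp [osetSummand, Oset]) using 2 with p
  exact (tsum_osetSummand_prime_pow hs p.2).symm

lemma chi4_eq_χ₄ (n : ℕ) : chi4 n = (ZMod.χ₄.ringHomComp (Int.castRingHom ℂ)) n := by
  rw [MulChar.ringHomComp_apply, ZMod.χ₄_nat_eq_if_mod_four, chi4]
  have := Nat.mod_lt n (show 0 < 4 by norm_num)
  split_ifs <;> first | omega | simp

lemma hasProd_chi4 {s : ℂ} (hs : 1 < s.re) :
    HasProd (fun p : Nat.Primes ↦ (1 - chi4 p * (p : ℂ) ^ (-s))⁻¹)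
      (∑' n : ℕ, chi4 n * (n : ℂ) ^ (-s)) := by
  have h := DirichletCharacter.LSeries_eulerProduct_hasProd
    (ZMod.χ₄.ringHomComp (Int.castRingHom ℂ)) hs
  rw [← tsum_dirichletSummand _ hs] at h
  simp only [chi4_eq_χ₄]
  exact h

lemma euler_factor_identity {s : ℂ} (hs : 1 < s.re) {p : ℕ} (hp : p.Prime) :
    (if p % 4 = 1 then (1 + (p : ℂ) ^ (-s)) / (1 - (p : ℂ) ^ (-s)) else 1) *
      ((if p = 2 then 1 + (2 : ℂ) ^ (-s) else 1) * (1 - (p : ℂ) ^ (-(2 * s)))⁻¹) =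
    (1 - (p : ℂ) ^ (-s))⁻¹ * (1 - chi4 p * (p : ℂ) ^ (-s))⁻¹ := by
  have hx := norm_prime_cpow_neg_lt_one hp (s := s) (by linarith)
  have hsq : (p : ℂ) ^ (-(2 * s)) = ((p : ℂ) ^ (-s)) ^ 2 := by
    rw [← Complex.cpow_nat_mul]
    congr 1
    push_cast
    ring
  have h2 : p = 2 → (2 : ℂ) ^ (-s) = (p : ℂ) ^ (-s) := by rintro rfl; simp
  rw [hsq]
  generalize (p : ℂ) ^ (-s) = x at *
  have hx1 : 1 - x ≠ 0 := sub_ne_zero.mpr fun h ↦ by simp [← h] at hx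
  have hx2 : 1 + x ≠ 0 := fun h ↦ by simp [eq_neg_of_add_eq_zero_right h] at hx
  have hfac : 1 - x ^ 2 = (1 - x) * (1 + x) := by ring
  rw [hfac]
  rcases hp.eq_two_or_odd with rfl | hodd
  · simp only [h2 rfl, chi4]
    norm_num
    field_simp
  · have hp2 : p ≠ 2 := by rintro rfl; norm_num at hodd
    obtain h | h : p % 4 = 1 ∨ p % 4 = 3 := by omega
    · simp only [h, hp2, chi4, if_true, if_false]
      field_simp
    · simp only [h, hp2, chi4, if_false]
      norm_num
      field_simp

/-- For `Re(s) > 1`,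
`Σ_{n ∈ O} 2^{ω(n)} n^{-s} = ζ(s) L(s,χ) / ((1 + 2^{-s}) ζ(2s))`,
where `L(s,χ) = Σ_{n ≥ 1} χ(n) n^{-s}` is the Dirichlet L-function of `χ`. -/
theorem F_eq_zeta_L (s : ℂ) (hs : 1 < s.re) :
    ∑' n : Oset, (2 ^ (n : ℕ).primeFactors.card : ℂ) * ((n : ℕ) : ℂ) ^ (-s)
      = riemannZeta s * (∑' n : ℕ, chi4 n * (n : ℂ) ^ (-s))
        / ((1 + (2 : ℂ) ^ (-s)) * riemannZeta (2 * s)) := by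
  have hs2 : 1 < (2 * s).re := by
    rw [Complex.mul_re]
    norm_num
    linarith
  have hlocal : HasProd (fun p : Nat.Primes ↦ if (p : ℕ) = 2 then 1 + (2 : ℂ) ^ (-s) else 1)
      (1 + (2 : ℂ) ^ (-s)) := by
    simpa using hasProd_single (f := fun p : Nat.Primes ↦
      if (p : ℕ) = 2 then 1 + (2 : ℂ) ^ (-s) else 1) ⟨2, Nat.prime_two⟩
      fun p hp ↦ if_neg fun h ↦ hp (Subtype.ext h)
  have hleft := (hasProd_osetSummand hs).mul
    (hlocal.mul (riemannZeta_eulerProduct_hasProd hs2))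
  have hright := (riemannZeta_eulerProduct_hasProd hs).mul (hasProd_chi4 hs)
  simp only [fun p : Nat.Primes ↦ euler_factor_identity hs p.2] at hleft
  have h2 : 1 + (2 : ℂ) ^ (-s) ≠ 0 := fun h ↦ by
    have hx := norm_prime_cpow_neg_lt_one Nat.prime_two (s := s) (by linarith)
    simp [eq_neg_of_add_eq_zero_right h] at hx
  rw [eq_div_iff (mul_ne_zero h2 (riemannZeta_ne_zero_of_one_lt_re hs2)),
    ← hleft.unique hright]
  congr 1
  exact tsum_subtype Oset fun n : ℕ ↦ (2 ^ n.primeFactors.card : ℂ) * (n : ℂ) ^ (-s)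
end
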